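/- arXiv:2211.04015 — 2 statements merged into one kernel-verified Lean document; each statement's English description precedes it below -/
import Mathlib

section
/- Suppose the algebra C(a,b,c,d;ε,δ) is curled. Then C(a,b,c,d;ε,δ) is commutative if and only if (a,b,c,d,ε,δ) is one of (0,0,0,0,0,0), (0,1,0,1,0,0), (1,0,1,0,0,0), (1,1,1,1,0,0), (0,0,0,0,1,1), (0,1,0,1,1,1), (1,0,1,0,1,1), (1,1,1,1,1,1). -/
/-- The field with two elements. -/
abbrev F2 : Type := ZMod 2

/-- The two-dimensional `F2`-vector space. -/
abbrev V : Type := F2 × F2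

/-- A two-dimensional algebra over `F2`: an `F2`-bilinear multiplication on `V`. -/
abbrev Mul2 : Type := V →ₗ[F2] V →ₗ[F2] V

/-- The two-dimensional algebra over `F2` whose structure matrix (w.r.t. the standard
basis `e = (1,0)`, `f = (0,1)`) is `M`; the rows of `M` give `e²`, `f²`, `e·f`, `f·e`. -/
def mulOf (M : Matrix (Fin 4) (Fin 2) F2) : Mul2 :=
  LinearMap.mk₂ F2
    (fun x y =>
      (x.1 * y.1 * M 0 0 + x.2 * y.2 * M 1 0 + x.1 * y.2 * M 2 0 + x.2 * y.1 * M 3 0,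
       x.1 * y.1 * M 0 1 + x.2 * y.2 * M 1 1 + x.1 * y.2 * M 2 1 + x.2 * y.1 * M 3 1))
    (by intro m n p; simp [Prod.ext_iff]; constructor <;> ring)
    (by intro c m p; simp [Prod.ext_iff, smul_eq_mul]; constructor <;> ring)
    (by intro m n p; simp [Prod.ext_iff]; constructor <;> ring)
    (by intro c m p; simp [Prod.ext_iff, smul_eq_mul]; constructor <;> ring)

/-- The first standard basis vector. -/
def e : V := (1, 0)

/-- The second standard basis vector. -/
def f : V := (0, 1)

/-- The structure matrix of a two-dimensional algebra over `F2` w.r.t. the standard basis: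
its rows are the coordinates of `e²`, `f²`, `e·f`, `f·e`. -/
def structMatrix (μ : Mul2) : Matrix (Fin 4) (Fin 2) F2 :=
  ![![(μ e e).1, (μ e e).2],
    ![(μ f f).1, (μ f f).2],
    ![(μ e f).1, (μ e f).2],
    ![(μ f e).1, (μ f e).2]]

/-- Two two-dimensional algebras over `F2` are isomorphic: there is an `F2`-linear
bijection preserving multiplication. -/
def IsIso (μ μ' : Mul2) : Prop :=
  ∃ φ : V ≃ₗ[F2] V, ∀ x y : V, φ (μ x y) = μ' (φ x) (φ y)

/-- An algebra is endo-commutative if `(x·x)·(y·y) = (x·y)·(x·y)` for all `x, y`. -/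
def EndoCommutative (μ : Mul2) : Prop :=
  ∀ x y : V, μ (μ x x) (μ y y) = μ (μ x y) (μ x y)

/-- An algebra is curled if every square `x·x` is a scalar multiple of `x`. -/
def Curled (μ : Mul2) : Prop := ∀ x : V, ∃ lam : F2, μ x x = lam • x

/-- An algebra is commutative if `x·y = y·x` for all `x, y`. -/
def IsCommutative2 (μ : Mul2) : Prop := ∀ x y : V, μ x y = μ y x

/-- An algebra is associative if `(x·y)·z = x·(y·z)` for all `x, y, z`. -/
def IsAssociative2 (μ : Mul2) : Prop := ∀ x y z : V, μ (μ x y) z = μ x (μ y z)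

/-- An algebra is unital if it has a two-sided unit. -/
def IsUnital2 (μ : Mul2) : Prop := ∃ u : V, ∀ x : V, μ u x = x ∧ μ x u = x

/-- An algebra is zeropotent if `x·x = 0` for all `x`. -/
def Zeropotent (μ : Mul2) : Prop := ∀ x : V, μ x x = 0

/-- For `X = [[a,b],[c,d]]`, `tilde X` is the 4×4 matrix with rows
`(a,b,ab,ab)`, `(c,d,cd,cd)`, `(ac,bd,ad,bc)`, `(ac,bd,bc,ad)`. -/
def tilde (X : Matrix (Fin 2) (Fin 2) F2) : Matrix (Fin 4) (Fin 4) F2 :=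
  ![![X 0 0, X 0 1, X 0 0 * X 0 1, X 0 0 * X 0 1],
    ![X 1 0, X 1 1, X 1 0 * X 1 1, X 1 0 * X 1 1],
    ![X 0 0 * X 1 0, X 0 1 * X 1 1, X 0 0 * X 1 1, X 0 1 * X 1 0],
    ![X 0 0 * X 1 0, X 0 1 * X 1 1, X 0 1 * X 1 0, X 0 0 * X 1 1]]

/-- The curled-type algebra `C(a,b,c,d;ε,δ)`:
`e² = ε·e`, `f² = δ·f`, `e·f = a·e + b·f`, `f·e = c·e + d·f`. -/
def Calg (a b c d ε δ : F2) : Mul2 := mulOf ![![ε, 0], ![0, δ], ![a, b], ![c, d]]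

/-- The straight-type algebra `S(p,q,a,b,c,d)`:
`e² = f`, `f² = p·e + q·f`, `e·f = a·e + b·f`, `f·e = c·e + d·f`. -/
def Salg (p q a b c d : F2) : Mul2 := mulOf ![![0, 1], ![p, q], ![a, b], ![c, d]]

theorem Calg_apply (a b c d ε δ : F2) (x y : V) :
    Calg a b c d ε δ x y =
      (x.1 * y.1 * ε + x.1 * y.2 * a + x.2 * y.1 * c,
       x.2 * y.2 * δ + x.1 * y.2 * b + x.2 * y.1 * d) := by
  simp [Calg, mulOf]

/-- Evaluating the curled condition at `e + f` gives a relation between the parameters. -/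
theorem Curled.add_eq_add {a b c d ε δ : F2} (h : Curled (Calg a b c d ε δ)) :
    ε + a + c = δ + b + d := by
  obtain ⟨l, hl⟩ := h (1, 1)
  rw [Calg_apply, Prod.ext_iff] at hl
  simp only [Prod.smul_mk, smul_eq_mul, one_mul, mul_one] at hl
  exact hl.1.trans hl.2.symm

theorem Calg_isCommutative2_iff (a b c d ε δ : F2) :
    IsCommutative2 (Calg a b c d ε δ) ↔ a = c ∧ b = d := by
  constructor
  · intro h
    simpa [Calg_apply] using h (1, 0) (0, 1)
  · rintro ⟨rfl, rfl⟩ x y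
    rw [Calg_apply, Calg_apply]
    ext <;> ring

/-- A curled `C(a,b,c,d;ε,δ)` is commutative iff `(a,b,c,d,ε,δ)` is one of the
eight listed tuples. -/
theorem Calg_commutative_iff (a b c d ε δ : F2) (h : Curled (Calg a b c d ε δ)) :
    IsCommutative2 (Calg a b c d ε δ) ↔
      (((a, b, c, d, ε, δ) : F2 × F2 × F2 × F2 × F2 × F2) = (0, 0, 0, 0, 0, 0) ∨
       ((a, b, c, d, ε, δ) : F2 × F2 × F2 × F2 × F2 × F2) = (0, 1, 0, 1, 0, 0) ∨
       ((a, b, c, d, ε, δ) : F2 × F2 × F2 × F2 × F2 × F2) = (1, 0, 1, 0, 0, 0) ∨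
       ((a, b, c, d, ε, δ) : F2 × F2 × F2 × F2 × F2 × F2) = (1, 1, 1, 1, 0, 0) ∨
       ((a, b, c, d, ε, δ) : F2 × F2 × F2 × F2 × F2 × F2) = (0, 0, 0, 0, 1, 1) ∨
       ((a, b, c, d, ε, δ) : F2 × F2 × F2 × F2 × F2 × F2) = (0, 1, 0, 1, 1, 1) ∨
       ((a, b, c, d, ε, δ) : F2 × F2 × F2 × F2 × F2 × F2) = (1, 0, 1, 0, 1, 1) ∨
       ((a, b, c, d, ε, δ) : F2 × F2 × F2 × F2 × F2 × F2) = (1, 1, 1, 1, 1, 1)) := by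
  have hrel := h.add_eq_add
  rw [Calg_isCommutative2_iff]
  simp only [Prod.mk.injEq]
  constructor
  · rintro ⟨rfl, rfl⟩
    obtain rfl : ε = δ := by
      simpa only [add_assoc, CharTwo.add_self_eq_zero, add_zero] using hrel
    have h01 : ∀ x : F2, x = 0 ∨ x = 1 := by decide
    rcases h01 a with rfl | rfl <;> rcases h01 b with rfl | rfl <;>
      rcases h01 ε with rfl | rfl <;> simp
  · grind
end

section
/- For p,q,a,b,c,d ∈ F₂, the algebra S(p,q,a,b,c,d) is associative if and only if c=a, d=b, p=ab and q=a+b; equivalently, if and only if (p,q,a,b,c,d) is one of the four tuples (0,0,0,0,0,0), (0,1,0,1,0,1), (0,1,1,0,1,0), (1,0,1,1,1,1). -/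
theorem Salg_apply (p q a b c d : F2) (x y : V) :
    Salg p q a b c d x y =
      (x.2 * y.2 * p + x.1 * y.2 * a + x.2 * y.1 * c,
       x.1 * y.1 + x.2 * y.2 * q + x.1 * y.2 * b + x.2 * y.1 * d) := by
  simp [Salg, mulOf]

theorem F2.mul_self (b : F2) : b * b = b := by
  revert b
  decide

/-- Associativity of `S(p,q,a,b,c,d)` amounts to `e²·e = e·e²` and `e²·f = e·(e·f)`. -/
theorem Salg_associative_iff_coeffs (p q a b c d : F2) :
    IsAssociative2 (Salg p q a b c d) ↔ c = a ∧ d = b ∧ p = a * b ∧ q = a + b := by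
  constructor
  · intro h
    have heee := h e e e
    have heef := h e e f
    simp only [Salg_apply, e, f, Prod.mk.injEq] at heee heef
    simp only [mul_zero, zero_mul, mul_one, one_mul, add_zero, zero_add, F2.mul_self] at heee heef
    exact ⟨heee.1, heee.2, heef.1.trans (mul_comm b a), heef.2⟩
  · rintro ⟨rfl, rfl, rfl, rfl⟩ x y z
    have hd := F2.mul_self d
    simp only [Salg_apply, Prod.mk.injEq]
    generalize hq : c + d = q
    obtain rfl : q = c + d * d := by rw [hd, hq]
    constructor <;> ring

/-- `S(p,q,a,b,c,d)` is associative iff `c = a`, `d = b`, `p = ab` and `q = a + b`;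
equivalently, iff `(p,q,a,b,c,d)` is one of the four listed tuples. -/
theorem Salg_associative_iff (p q a b c d : F2) :
    (IsAssociative2 (Salg p q a b c d) ↔ (c = a ∧ d = b ∧ p = a * b ∧ q = a + b)) ∧
    (IsAssociative2 (Salg p q a b c d) ↔
      (((p, q, a, b, c, d) : F2 × F2 × F2 × F2 × F2 × F2) = (0, 0, 0, 0, 0, 0) ∨
       ((p, q, a, b, c, d) : F2 × F2 × F2 × F2 × F2 × F2) = (0, 1, 0, 1, 0, 1) ∨
       ((p, q, a, b, c, d) : F2 × F2 × F2 × F2 × F2 × F2) = (0, 1, 1, 0, 1, 0) ∨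
       ((p, q, a, b, c, d) : F2 × F2 × F2 × F2 × F2 × F2) = (1, 0, 1, 1, 1, 1))) := by
  refine ⟨Salg_associative_iff_coeffs p q a b c d, ?_⟩
  simp only [Salg_associative_iff_coeffs, Prod.mk.injEq]
  have ha : a = 0 ∨ a = 1 := by
    revert a
    decide
  have hb : b = 0 ∨ b = 1 := by
    revert b
    decide
  have htwo : (1 : F2) + 1 = 0 := rfl
  rcases ha with rfl | rfl <;> rcases hb with rfl | rfl <;> simp [htwo] <;> tauto
end
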